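/- Let k be an integer with 32 ≤ k ≤ 41, and let s be a finite multiset of integers, each at least 3, with card s ≥ 3 and combinatorial curvature Φ(s) = 1 − (card s)/2 + Σ_{j ∈ s} 1/j ≥ 0. If s contains the element k, then s is one of the following: {3,3,k}, {3,4,k}, {3,5,k}, {3,6,k}, {3,7,k}, {4,4,k}, or {3,3,3,k}. -/

import Mathlib

/-- Combinatorial curvature of a vertex pattern `s` (multiset of face degrees). -/
def curvature (s : Multiset ℤ) : ℚ :=
  1 - (s.card : ℚ) / 2 + (s.map (fun k => (1 : ℚ) / (k : ℚ))).sum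

theorem one_div_intCast_le {m j : ℤ} (hm : 0 < m) (h : m ≤ j) :
    (1 : ℚ) / (j : ℚ) ≤ 1 / (m : ℚ) :=
  one_div_le_one_div_of_le (by exact_mod_cast hm) (by exact_mod_cast h)

theorem curvature_cons (k : ℤ) (t : Multiset ℤ) :
    curvature (k ::ₘ t) = curvature t + (1 / (k : ℚ) - 1 / 2) := by
  simp only [curvature, Multiset.card_cons, Multiset.bind_def, Multiset.cons_bind,
    Multiset.pure_def, Multiset.map_add, Multiset.map_singleton, Multiset.sum_add,
    Multiset.sum_singleton]
  push_cast
  ring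

theorem curvature_le_of_three_le {t : Multiset ℤ} (ht : ∀ j ∈ t, (3 : ℤ) ≤ j) :
    curvature t ≤ 1 - (t.card : ℚ) / 6 := by
  induction t using Multiset.induction with
  | empty => simp [curvature]
  | cons a t ih =>
    have h := ih fun j hj => ht j (Multiset.mem_cons_of_mem hj)
    have ha := one_div_intCast_le (by norm_num) (ht a (Multiset.mem_cons_self a t))
    rw [curvature_cons, Multiset.card_cons]
    push_cast at ha ⊢
    linarith

/-- The pairs of integers `3 ≤ a ≤ b` with `1 / a + 1 / b ≥ 15 / 32`. -/
theorem pair_of_reciprocal_sum_ge {a b : ℤ} (ha : 3 ≤ a) (hab : a ≤ b)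
    (h : (15 : ℚ) / 32 ≤ 1 / (a : ℚ) + 1 / (b : ℚ)) :
    (a = 3 ∧ b ≤ 7) ∨ (a = 4 ∧ b = 4) := by
  have hab' := one_div_intCast_le (by lia) hab
  have ha4 : a ≤ 4 := by
    by_contra! hlt
    have := one_div_intCast_le (m := 5) (by norm_num) hlt
    push_cast at this
    linarith
  obtain rfl | rfl : a = 3 ∨ a = 4 := by lia
  · refine Or.inl ⟨rfl, ?_⟩
    by_contra! hlt
    have := one_div_intCast_le (m := 8) (by norm_num) hlt
    push_cast at this h
    linarith
  · refine Or.inr ⟨rfl, le_antisymm ?_ hab⟩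
    by_contra! hlt
    have := one_div_intCast_le (m := 5) (by norm_num) hlt
    push_cast at this h
    linarith

/-- A triple of integers at least `3` with reciprocal sum at least `31 / 32` starts with `3`. -/
theorem eq_three_of_reciprocal_sum_ge {a b c : ℤ} (ha : 3 ≤ a) (hb : 3 ≤ b) (hc : 3 ≤ c)
    (h : (31 : ℚ) / 32 ≤ 1 / (a : ℚ) + 1 / (b : ℚ) + 1 / (c : ℚ)) : a = 3 := by
  refine le_antisymm ?_ ha
  by_contra! hlt
  have ha' := one_div_intCast_le (m := 4) (by norm_num) hlt
  have hb' := one_div_intCast_le (by norm_num) hb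
  have hc' := one_div_intCast_le (by norm_num) hc
  push_cast at ha' hb' hc'
  linarith

theorem patterns_on_large_kgon (k : ℤ) (hk1 : 32 ≤ k) (hk2 : k ≤ 41)
    (s : Multiset ℤ) (h3 : ∀ j ∈ s, (3 : ℤ) ≤ j) (hcard : 3 ≤ Multiset.card s)
    (hΦ : 0 ≤ curvature s) (hkmem : k ∈ s) :
    s = {3, 3, k} ∨ s = {3, 4, k} ∨ s = {3, 5, k} ∨ s = {3, 6, k} ∨
      s = {3, 7, k} ∨ s = {4, 4, k} ∨ s = {3, 3, 3, k} := by
  obtain ⟨t, rfl⟩ := Multiset.exists_cons_of_mem hkmem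
  have ht : ∀ j ∈ t, (3 : ℤ) ≤ j := fun j hj => h3 j (Multiset.mem_cons_of_mem hj)
  have hk := one_div_intCast_le (by norm_num) hk1
  push_cast at hk
  rw [curvature_cons] at hΦ
  rw [Multiset.card_cons] at hcard
  have hle : t.card ≤ 3 := by
    have h := curvature_le_of_three_le ht
    by_contra! hlt
    have : (4 : ℚ) ≤ t.card := by exact_mod_cast hlt
    linarith
  obtain h2 | h2 : t.card = 2 ∨ t.card = 3 := by lia
  · obtain ⟨a, b, hab, rfl⟩ : ∃ a b, a ≤ b ∧ t = {a, b} := by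
      obtain ⟨a, b, rfl⟩ := Multiset.card_eq_two.mp h2
      rcases le_total a b with h | h
      · exact ⟨a, b, h, rfl⟩
      · exact ⟨b, a, h, Multiset.pair_comm a b⟩
    have hs : k ::ₘ {a, b} = ({a, b, k} : Multiset ℤ) := by
      simp only [Multiset.insert_eq_cons]
      rw [Multiset.cons_swap, ← Multiset.insert_eq_cons k {b}, Multiset.pair_comm]
      rfl
    have ha : 3 ≤ a := ht a (by simp)
    have hsum : (15 : ℚ) / 32 ≤ 1 / (a : ℚ) + 1 / (b : ℚ) := by
      simp [curvature] at hΦ hk ⊢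
      linarith
    rw [hs]
    rcases pair_of_reciprocal_sum_ge ha hab hsum with ⟨rfl, hb⟩ | ⟨rfl, rfl⟩
    · interval_cases b <;> simp
    · simp
  · obtain ⟨a, b, c, rfl⟩ := Multiset.card_eq_three.mp h2
    have ha : 3 ≤ a := ht a (by simp)
    have hb : 3 ≤ b := ht b (by simp)
    have hc : 3 ≤ c := ht c (by simp)
    have hsum : (31 : ℚ) / 32 ≤ 1 / (a : ℚ) + 1 / (b : ℚ) + 1 / (c : ℚ) := by
      simp [curvature] at hΦ hk ⊢
      linarith
    obtain rfl := eq_three_of_reciprocal_sum_ge ha hb hc hsum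
    obtain rfl := eq_three_of_reciprocal_sum_ge hb hc ha (by linarith)
    obtain rfl := eq_three_of_reciprocal_sum_ge hc ha hb (by linarith)
    iterate 6 right
    simp only [Multiset.insert_eq_cons]
    rw [Multiset.cons_swap, Multiset.cons_swap k, ← Multiset.insert_eq_cons k {3},
      Multiset.pair_comm]
    rfl
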